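/- Let n ≥ 2 and let h : ℝⁿ₊ → ℝ be differentiable with 1/2 ≤ h(x,t) ≤ 2 and 2t|∇h(x,t)| < h(x,t) for all (x,t) ∈ ℝⁿ₊ = ℝ^{n-1}×(0,∞). Then the map ρ(x,t) = (x, t·h(x,t)) is a bijection from ℝⁿ₊ onto ℝⁿ₊. -/

import Mathlib

open MeasureTheory Set Filter
open scoped ENNReal NNReal

noncomputable section

/-! ## Basic geometry of the upper half-space `ℝⁿ₊ = ℝ^{n-1} × (0,∞)` -/

abbrev EE (n : ℕ) := EuclideanSpace ℝ (Fin (n - 1))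
abbrev Pt (n : ℕ) := EE n × ℝ

/-- The upper half-space `ℝⁿ₊`. -/
def UHS (n : ℕ) : Set (Pt n) := {X | 0 < X.2}

/-- Euclidean distance on `ℝ^{n-1} × ℝ`. -/
def dist2 {n : ℕ} (X Y : Pt n) : ℝ := Real.sqrt (dist X.1 Y.1 ^ 2 + (X.2 - Y.2) ^ 2)

/-- Euclidean ball in `ℝ^{n-1} × ℝ`. -/
def ball2 {n : ℕ} (X : Pt n) (r : ℝ) : Set (Pt n) := {Y | dist2 Y X < r}

/-- Whitney ball `B(X, δ(X)/2)` for the upper half-space (`δ(X) = t`). -/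
def wball {n : ℕ} (X : Pt n) : Set (Pt n) := ball2 X (X.2 / 2)

/-- Nontangential cone of aperture `a` with vertex `q ∈ ℝ^{n-1} = ∂ℝⁿ₊`. -/
def cone {n : ℕ} (a : ℝ) (q : EE n) : Set (Pt n) :=
  {X | 0 < X.2 ∧ dist2 X (q, 0) ≤ (1 + a) * X.2}

/-- Cone truncated at height `h`. -/
def coneTrunc {n : ℕ} (a h : ℝ) (q : EE n) : Set (Pt n) := cone a q ∩ {X | X.2 < h}

/-- Doubly truncated cone `Γ_ε(q)`. -/
def coneEps {n : ℕ} (a ε : ℝ) (q : EE n) : Set (Pt n) :=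
  cone a q ∩ {X | ε < X.2 ∧ X.2 < 1 / ε}

/-! ## Derivatives -/

/-- The `i`-th coordinate direction in `ℝ^{n-1} × ℝ`. -/
def bvec (n : ℕ) (i : Fin n) : Pt n :=
  if h : (i : ℕ) < n - 1 then (EuclideanSpace.single (⟨i, h⟩ : Fin (n - 1)) 1, 0)
  else ((0 : EE n), 1)

/-- Partial derivative of `u` in the `i`-th coordinate direction. -/
def pd {n : ℕ} (i : Fin n) (u : Pt n → ℝ) (X : Pt n) : ℝ := fderiv ℝ u X (bvec n i)

/-- Horizontal partial derivative. -/
def pdx {n : ℕ} (i : Fin (n - 1)) (u : Pt n → ℝ) (X : Pt n) : ℝ :=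
  fderiv ℝ u X (EuclideanSpace.single i 1, 0)

/-- Vertical partial derivative `∂_t`. -/
def pdt {n : ℕ} (u : Pt n → ℝ) (X : Pt n) : ℝ := fderiv ℝ u X (0, 1)

/-- Squared length of the full gradient of `u`. -/
def gradSq {n : ℕ} (u : Pt n → ℝ) (X : Pt n) : ℝ := ∑ i : Fin n, pd i u X ^ 2

/-- Squared length of the horizontal gradient of `u`. -/
def gradxSq {n : ℕ} (u : Pt n → ℝ) (X : Pt n) : ℝ := ∑ i : Fin (n - 1), pdx i u X ^ 2

/-- Squared Hilbert–Schmidt norm of the Hessian of `u`. -/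
def hessSq {n : ℕ} (u : Pt n → ℝ) (X : Pt n) : ℝ :=
  ∑ i : Fin n, ∑ j : Fin n, pd i (pd j u) X ^ 2

/-- Partial derivative of a function on the boundary `ℝ^{n-1}` (or `ℝ^d`). -/
def pdE {d : ℕ} (i : Fin d) (f : EuclideanSpace ℝ (Fin d) → ℝ)
    (q : EuclideanSpace ℝ (Fin d)) : ℝ :=
  fderiv ℝ f q (EuclideanSpace.single i 1)

/-- Squared length of the gradient of a boundary function. -/
def gradSqE {d : ℕ} (f : EuclideanSpace ℝ (Fin d) → ℝ) (q : EuclideanSpace ℝ (Fin d)) : ℝ :=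
  ∑ i, pdE i f q ^ 2

/-- Frobenius norm of an `m × m` matrix. -/
def mnorm {m : ℕ} (M : Fin m → Fin m → ℝ) : ℝ := Real.sqrt (∑ p, ∑ q, M p q ^ 2)

/-- Norm of the full gradient of a matrix-valued function. -/
def gradA {n m : ℕ} (A : Pt n → Fin m → Fin m → ℝ) (X : Pt n) : ℝ :=
  Real.sqrt (∑ p, ∑ q, gradSq (fun Y => A Y p q) X)

/-- Norm of the horizontal gradient of a matrix-valued function. -/
def gradxA {n m : ℕ} (A : Pt n → Fin m → Fin m → ℝ) (X : Pt n) : ℝ :=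
  Real.sqrt (∑ p, ∑ q, gradxSq (fun Y => A Y p q) X)

/-! ## Nontangential maximal functions, square functions, norms -/

/-- Nontangential maximal function. -/
def NT {n : ℕ} (a : ℝ) (F : Pt n → ℝ) (q : EE n) : ℝ≥0∞ :=
  ⨆ X ∈ cone a q, ENNReal.ofReal |F X|

/-- Nontangential maximal function of a vector-valued function. -/
def NTv {n m : ℕ} (a : ℝ) (w : Fin m → Pt n → ℝ) (q : EE n) : ℝ≥0∞ :=
  ⨆ X ∈ cone a q, ENNReal.ofReal (Real.sqrt (∑ k, w k X ^ 2))

/-- `L²`-averaged nontangential maximal function `Ñ`, applied to the *squared*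
density `G` (e.g. `G = |∇u|²`). -/
def NTav {n : ℕ} (a : ℝ) (G : Pt n → ℝ) (q : EE n) : ℝ≥0∞ :=
  ⨆ X ∈ cone a q,
    ((volume (wball X))⁻¹ * ∫⁻ Y in wball X, ENNReal.ofReal (G Y)) ^ (1 / 2 : ℝ)

/-- Truncated version of `NTav` (cones truncated at height `h`). -/
def NTavTr {n : ℕ} (a h : ℝ) (G : Pt n → ℝ) (q : EE n) : ℝ≥0∞ :=
  ⨆ X ∈ coneTrunc a h q,
    ((volume (wball X))⁻¹ * ∫⁻ Y in wball X, ENNReal.ofReal (G Y)) ^ (1 / 2 : ℝ)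

/-- `L¹`-averaged nontangential maximal function, over a general family `Γ` of points. -/
def NT1on {n : ℕ} (Γ : Set (Pt n)) (F : Pt n → ℝ) : ℝ≥0∞ :=
  ⨆ X ∈ Γ, (volume (wball X))⁻¹ * ∫⁻ Y in wball X, ENNReal.ofReal |F Y|

/-- Square function over a region `Γ`, applied to the *squared* density `G = |∇v|²`. -/
def SFon {n : ℕ} (Γ : Set (Pt n)) (G : Pt n → ℝ) : ℝ≥0∞ :=
  (∫⁻ X in Γ, ENNReal.ofReal (G X) * ENNReal.ofReal (X.2 ^ ((2 : ℝ) - n))) ^ (1 / 2 : ℝ)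

/-- Square function with aperture `a`, applied to the squared density `G = |∇v|²`. -/
def SF {n : ℕ} (a : ℝ) (G : Pt n → ℝ) (q : EE n) : ℝ≥0∞ := SFon (cone a q) G

/-- `L^p` (quasi-)norm over `ℝ^{n-1}` of an `ℝ≥0∞`-valued function. -/
def bLp {d : ℕ} (p : ℝ) (g : EuclideanSpace ℝ (Fin d) → ℝ≥0∞) : ℝ≥0∞ :=
  (∫⁻ q, g q ^ p) ^ (1 / p)

/-- `L^p` (quasi-)norm over a subset `S ⊆ ℝ^{n-1}`. -/
def bLpOn {d : ℕ} (p : ℝ) (S : Set (EuclideanSpace ℝ (Fin d)))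
    (g : EuclideanSpace ℝ (Fin d) → ℝ≥0∞) : ℝ≥0∞ :=
  (∫⁻ q in S, g q ^ p) ^ (1 / p)

/-- Localized Hardy–Littlewood maximal function, over balls contained in `R`. -/
def MHL {d : ℕ} (R : Set (EuclideanSpace ℝ (Fin d))) (g : EuclideanSpace ℝ (Fin d) → ℝ≥0∞)
    (x : EuclideanSpace ℝ (Fin d)) : ℝ≥0∞ :=
  ⨆ (z : EuclideanSpace ℝ (Fin d)) (ρ : ℝ) (_ : 0 < ρ) (_ : x ∈ Metric.ball z ρ)
      (_ : Metric.ball z ρ ⊆ R),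
    (volume (Metric.ball z ρ))⁻¹ * ∫⁻ y in Metric.ball z ρ, g y

/-! ## Carleson measures on the half-space -/

/-- `μ` is a Carleson measure on `ℝⁿ₊` with norm at most `K`. -/
def CarlNormLE {n : ℕ} (μ : Measure (Pt n)) (K : ℝ) : Prop :=
  ∀ (q : EE n) (r : ℝ), 0 < r →
    μ (Metric.ball q r ×ˢ Ioo 0 r) ≤ ENNReal.ofReal K * volume (Metric.ball q r)

/-- `μ` is a Carleson measure on `ℝⁿ₊`. -/
def IsCarleson {n : ℕ} (μ : Measure (Pt n)) : Prop := ∃ K : ℝ, 0 ≤ K ∧ CarlNormLE μ K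

/-- The measure with density `g` with respect to Lebesgue measure. -/
def densM {n : ℕ} (g : Pt n → ℝ≥0∞) : Measure (Pt n) := volume.withDensity g

/-! ## Ellipticity, weak solutions, solvability (half-space) -/

/-- Uniform ellipticity of an `m × m` matrix-valued function on `Ω`. -/
def EllipticOn {n m : ℕ} (Ω : Set (Pt n)) (A : Pt n → Fin m → Fin m → ℝ)
    (lam Lam : ℝ) : Prop :=
  ∀ X ∈ Ω,
    (∀ ξ : Fin m → ℝ, lam * ∑ i, ξ i ^ 2 ≤ ∑ i, ∑ j, A X i j * ξ j * ξ i) ∧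
    (∀ ξ η : Fin m → ℝ, |∑ i, ∑ j, A X i j * ξ j * η i| ≤
      Lam * Real.sqrt (∑ i, ξ i ^ 2) * Real.sqrt (∑ i, η i ^ 2))

/-- Smooth compactly supported test function with support in `Ω`. -/
def TestFun {n : ℕ} (Ω : Set (Pt n)) (ϕ : Pt n → ℝ) : Prop :=
  ContDiff ℝ (⊤ : ℕ∞) ϕ ∧ HasCompactSupport ϕ ∧ tsupport ϕ ⊆ Ω

/-- Weak solution of `div(A∇u)=0` in `ℝⁿ₊`. -/
def WeakSolution {n : ℕ} (A : Pt n → Fin n → Fin n → ℝ) (u : Pt n → ℝ) : Prop :=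
  (∀ X ∈ UHS n, DifferentiableAt ℝ u X) ∧
  ∀ ϕ : Pt n → ℝ, TestFun (UHS n) ϕ →
    (∫ X in UHS n, ∑ i, ∑ j, A X i j * pd j u X * pd i ϕ X) = 0

/-- Finite Dirichlet energy: `u ∈ Ẇ^{1,2}(ℝⁿ₊)`. -/
def FiniteEnergy {n : ℕ} (u : Pt n → ℝ) : Prop :=
  (∫⁻ X in UHS n, ENNReal.ofReal (gradSq u X)) < ⊤

/-- `u` has (vertical nontangential) boundary trace `f`. -/
def HasTrace {n : ℕ} (u : Pt n → ℝ) (f : EE n → ℝ) : Prop :=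
  ∀ q : EE n, Tendsto (fun t : ℝ => u (q, t)) (nhdsWithin 0 (Ioi 0)) (nhds (f q))

/-- Energy solution of the Dirichlet problem with data `f`. -/
def EnergySolution {n : ℕ} (A : Pt n → Fin n → Fin n → ℝ) (u : Pt n → ℝ)
    (f : EE n → ℝ) : Prop :=
  WeakSolution A u ∧ FiniteEnergy u ∧ HasTrace u f

/-- Solvability of the `L^p` Dirichlet problem in `ℝⁿ₊`. -/
def DirichletSolvable {n : ℕ} (A : Pt n → Fin n → Fin n → ℝ) (p : ℝ) : Prop :=
  ∃ C : ℝ, 0 < C ∧ ∀ u f, EnergySolution A u f →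
    bLp p (NT 1 u) ≤ ENNReal.ofReal C * bLp p (fun q => ENNReal.ofReal |f q|)

/-- Solvability of the `L^p` Regularity problem in `ℝⁿ₊`. -/
def RegularitySolvable {n : ℕ} (A : Pt n → Fin n → Fin n → ℝ) (p : ℝ) : Prop :=
  ∃ C : ℝ, 0 < C ∧ ∀ u f, EnergySolution A u f → (∀ q, DifferentiableAt ℝ f q) →
    bLp p (NTav 1 (gradSq u)) ≤
      ENNReal.ofReal C * bLp p (fun q => ENNReal.ofReal (gradSqE f q) ^ (1 / 2 : ℝ))

/-- The `n × n` block matrix built from an `(n-1) × (n-1)` matrix `A_∥`. -/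
def blockOf {n : ℕ} (Apar : Pt n → Fin (n - 1) → Fin (n - 1) → ℝ) (X : Pt n)
    (i j : Fin n) : ℝ :=
  if h : (i : ℕ) < n - 1 ∧ (j : ℕ) < n - 1 then Apar X ⟨i, h.1⟩ ⟨j, h.2⟩
  else if (i : ℕ) = (j : ℕ) then 1 else 0

/-- The upper-left `(n-1) × (n-1)` block `A_∥` of an `n × n` matrix. -/
def parOf {n : ℕ} (A : Pt n → Fin n → Fin n → ℝ) (X : Pt n)
    (i j : Fin (n - 1)) : ℝ :=
  A X (Fin.castLE (Nat.sub_le n 1) i) (Fin.castLE (Nat.sub_le n 1) j)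

/-- Transpose of a matrix-valued function. -/
def transp {n m : ℕ} (A : Pt n → Fin m → Fin m → ℝ) : Pt n → Fin m → Fin m → ℝ :=
  fun X i j => A X j i

/-! ## Lipschitz graph domains -/

/-- The domain above the graph of `φ`. -/
def gdom {n : ℕ} (φ : EE n → ℝ) : Set (Pt n) := {X | φ X.1 < X.2}

/-- Distance to the boundary (the graph of `φ`). -/
def gdist {n : ℕ} (φ : EE n → ℝ) (X : Pt n) : ℝ := ⨅ q : EE n, dist2 X (q, φ q)

/-- Whitney ball in a graph domain. -/
def gwball {n : ℕ} (φ : EE n → ℝ) (X : Pt n) : Set (Pt n) := ball2 X (gdist φ X / 2)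

/-- Nontangential cone at the boundary point `(q, φ q)`. -/
def gcone {n : ℕ} (φ : EE n → ℝ) (a : ℝ) (q : EE n) : Set (Pt n) :=
  {X | X ∈ gdom φ ∧ dist2 X (q, φ q) ≤ (1 + a) * gdist φ X}

/-- Truncated cone in a graph domain. -/
def gconeTrunc {n : ℕ} (φ : EE n → ℝ) (a h : ℝ) (q : EE n) : Set (Pt n) :=
  gcone φ a q ∩ {X | dist2 X (q, φ q) < h}

/-- Nontangential maximal function in a graph domain. -/
def gNT {n : ℕ} (φ : EE n → ℝ) (a : ℝ) (F : Pt n → ℝ) (q : EE n) : ℝ≥0∞ :=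
  ⨆ X ∈ gcone φ a q, ENNReal.ofReal |F X|

/-- Truncated nontangential maximal function of a vector-valued function. -/
def gNTvTr {n m : ℕ} (φ : EE n → ℝ) (a h : ℝ) (w : Fin m → Pt n → ℝ) (q : EE n) : ℝ≥0∞ :=
  ⨆ X ∈ gconeTrunc φ a h q, ENNReal.ofReal (Real.sqrt (∑ k, w k X ^ 2))

/-- `L²`-averaged nontangential maximal function in a graph domain,
applied to the squared density `G`. -/
def gNTav {n : ℕ} (φ : EE n → ℝ) (a : ℝ) (G : Pt n → ℝ) (q : EE n) : ℝ≥0∞ :=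
  ⨆ X ∈ gcone φ a q,
    ((volume (gwball φ X))⁻¹ * ∫⁻ Y in gwball φ X, ENNReal.ofReal (G Y)) ^ (1 / 2 : ℝ)

/-- Square function over a region in a graph domain (squared density `G`). -/
def gSFon {n : ℕ} (φ : EE n → ℝ) (Γ : Set (Pt n)) (G : Pt n → ℝ) : ℝ≥0∞ :=
  (∫⁻ X in Γ, ENNReal.ofReal (G X) * ENNReal.ofReal (gdist φ X ^ ((2 : ℝ) - n))) ^ (1 / 2 : ℝ)

/-- Carleson measure condition in a graph domain (surface measure of a boundary
ball of radius `r` is comparable to `r^{n-1}`). -/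
def gCarlNormLE {n : ℕ} (φ : EE n → ℝ) (μ : Measure (Pt n)) (K : ℝ) : Prop :=
  ∀ (q : EE n) (r : ℝ), 0 < r →
    μ (ball2 (q, φ q) r ∩ gdom φ) ≤ ENNReal.ofReal (K * r ^ (n - 1))

def gIsCarleson {n : ℕ} (φ : EE n → ℝ) (μ : Measure (Pt n)) : Prop :=
  ∃ K : ℝ, 0 ≤ K ∧ gCarlNormLE φ μ K

/-- The density of the oscillation Carleson measure
`δ(X)^{-1} [sup_{Y,Z ∈ B(X,δ(X)/2)} |A(Y) - A(Z)|]²`. -/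
def oscDens {n : ℕ} (φ : EE n → ℝ) (A : Pt n → Fin n → Fin n → ℝ) (X : Pt n) : ℝ≥0∞ :=
  (ENNReal.ofReal (gdist φ X))⁻¹ *
    (⨆ Y ∈ gwball φ X, ⨆ Z ∈ gwball φ X,
        ENNReal.ofReal (mnorm fun p q => A Y p q - A Z p q)) ^ 2

/-- `u` has boundary trace `f` on the graph (vertical nontangential limits). -/
def gHasTrace {n : ℕ} (φ : EE n → ℝ) (u : Pt n → ℝ) (f : EE n → ℝ) : Prop :=
  ∀ q : EE n, Tendsto (fun t : ℝ => u (q, φ q + t)) (nhdsWithin 0 (Ioi 0)) (nhds (f q))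

/-- Weak solution of `div(A∇u)=0` in the graph domain. -/
def gWeakSolution {n : ℕ} (φ : EE n → ℝ) (A : Pt n → Fin n → Fin n → ℝ)
    (u : Pt n → ℝ) : Prop :=
  (∀ X ∈ gdom φ, DifferentiableAt ℝ u X) ∧
  ∀ ϕ : Pt n → ℝ, TestFun (gdom φ) ϕ →
    (∫ X in gdom φ, ∑ i, ∑ j, A X i j * pd j u X * pd i ϕ X) = 0

def gFiniteEnergy {n : ℕ} (φ : EE n → ℝ) (u : Pt n → ℝ) : Prop :=
  (∫⁻ X in gdom φ, ENNReal.ofReal (gradSq u X)) < ⊤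

def gEnergySolution {n : ℕ} (φ : EE n → ℝ) (A : Pt n → Fin n → Fin n → ℝ)
    (u : Pt n → ℝ) (f : EE n → ℝ) : Prop :=
  gWeakSolution φ A u ∧ gFiniteEnergy φ u ∧ gHasTrace φ u f

/-- Solvability of the `L^p` Dirichlet problem in the graph domain. -/
def gDirichletSolvable {n : ℕ} (φ : EE n → ℝ) (A : Pt n → Fin n → Fin n → ℝ)
    (p : ℝ) : Prop :=
  ∃ C : ℝ, 0 < C ∧ ∀ u f, gEnergySolution φ A u f →
    bLp p (gNT φ 1 u) ≤ ENNReal.ofReal C * bLp p (fun q => ENNReal.ofReal |f q|)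

/-- Solvability of the `L^p` Regularity problem in the graph domain; the boundary
datum is identified with a function `f` of `x ∈ ℝ^{n-1}`, and `∇_T f` with `∇_x f`. -/
def gRegularitySolvable {n : ℕ} (φ : EE n → ℝ) (A : Pt n → Fin n → Fin n → ℝ)
    (p : ℝ) : Prop :=
  ∃ C : ℝ, 0 < C ∧ ∀ u f, gEnergySolution φ A u f → (∀ q, DifferentiableAt ℝ f q) →
    bLp p (gNTav φ 1 (gradSq u)) ≤
      ENNReal.ofReal C * bLp p (fun q => ENNReal.ofReal (gradSqE f q) ^ (1 / 2 : ℝ))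

/-- Solvability of the `L^p` Neumann problem in the graph domain. The co-normal
data `f` is identified with a function of `x ∈ ℝ^{n-1}`. -/
def gNeumannSolvable {n : ℕ} (φ : EE n → ℝ) (A : Pt n → Fin n → Fin n → ℝ)
    (p : ℝ) : Prop :=
  ∃ C : ℝ, 0 < C ∧ ∀ (u : Pt n → ℝ) (f : EE n → ℝ),
    (∀ X ∈ gdom φ, DifferentiableAt ℝ u X) → gFiniteEnergy φ u →
    Integrable f → (∫ q, f q) = 0 →
    (∀ η : Pt n → ℝ, ContDiff ℝ (⊤ : ℕ∞) η → HasCompactSupport η →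
      (∫ X in gdom φ, ∑ i, ∑ j, A X i j * pd j u X * pd i η X) = ∫ q, f q * η (q, φ q)) →
    bLp p (gNTav φ 1 (gradSq u)) ≤ ENNReal.ofReal C * bLp p (fun q => ENNReal.ofReal |f q|)

/-! ## The weakly coupled system of Section 5 -/

/-- The common setup for the weakly coupled system: `B_∥` satisfies the Carleson
condition with constant `M`, the `v_m` are energy solutions of the block-form
operator with data `∂_m f`, and `η` solves the weakly coupled system with zero
boundary data. -/
def WCSetup {n : ℕ} (Bpar : Pt n → Fin (n - 1) → Fin (n - 1) → ℝ) (M : ℝ)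
    (f : EE n → ℝ) (v η : Fin (n - 1) → Pt n → ℝ) : Prop :=
  LocallyLipschitz Bpar ∧
  CarlNormLE (densM fun X => ENNReal.ofReal (gradxA Bpar X ^ 2 * X.2)) M ∧
  (∀ X ∈ UHS n, (X.2 * gradxA Bpar X) ^ 2 ≤ M) ∧
  (∫⁻ q, ENNReal.ofReal (gradSqE f q)) < ⊤ ∧
  (∀ q, DifferentiableAt ℝ f q) ∧
  (∀ m : Fin (n - 1), EnergySolution (blockOf Bpar) (v m) (fun q => pdE m f q)) ∧
  (∀ m : Fin (n - 1),
    (∀ X ∈ UHS n, DifferentiableAt ℝ (η m) X) ∧ FiniteEnergy (η m) ∧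
    HasTrace (η m) (fun _ => 0) ∧
    ∀ ϕ : Pt n → ℝ, TestFun (UHS n) ϕ →
      (∫ X in UHS n, (∑ i : Fin (n - 1), ∑ j : Fin (n - 1),
          Bpar X i j * pdx j (η m) X * pdx i ϕ X) + pdt (η m) X * pdt ϕ X) =
        -∫ X in UHS n, ∑ i : Fin (n - 1), ∑ j : Fin (n - 1),
            pdx m (fun Z => Bpar Z i j) X * (v j X + η j X) * pdx i ϕ X)


/-- **Feneuil's change of variables.** If `1/2 ≤ h ≤ 2` and
`2t|∇h| < h` on `ℝⁿ₊`, then `ρ(x,t) = (x, t·h(x,t))` is a bijection of the upper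
half-space onto itself. -/
theorem feneuil_bijection (n : ℕ) (hn : 2 ≤ n) (h : Pt n → ℝ)
    (hdiff : ∀ X ∈ UHS n, DifferentiableAt ℝ h X)
    (hbd : ∀ X ∈ UHS n, 1 / 2 ≤ h X ∧ h X ≤ 2)
    (hgrad : ∀ X ∈ UHS n, 2 * X.2 * ‖fderiv ℝ h X‖ < h X) :
    Set.BijOn (fun X : Pt n => (X.1, X.2 * h X)) (UHS n) (UHS n) := by
  have hder : ∀ (x : EE n) (t : ℝ), 0 < t →
      HasDerivAt (fun s : ℝ => s * h (x, s)) (h (x, t) + t * fderiv ℝ h (x, t) (0, 1)) t := by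
    intro x t ht
    have h1 : HasFDerivAt h (fderiv ℝ h (x, t)) (x, t) := (hdiff (x, t) ht).hasFDerivAt
    have h2 : HasDerivAt (fun s : ℝ => ((x, s) : Pt n)) (0, 1) t :=
      (hasDerivAt_const t x).prodMk (hasDerivAt_id t)
    have h3 : HasDerivAt (fun s : ℝ => h (x, s)) (fderiv ℝ h (x, t) (0, 1)) t :=
      h1.comp_hasDerivAt t h2
    have h4 := (hasDerivAt_id t).mul h3
    simp only [id_eq, one_mul] at h4
    exact h4
  have hpos : ∀ (x : EE n) (t : ℝ), 0 < t →
      0 < h (x, t) + t * fderiv ℝ h (x, t) (0, 1) := by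
    intro x t ht
    have h1 := hgrad (x, t) ht
    have h2 := (hbd (x, t) ht).1
    have h3 : ‖fderiv ℝ h (x, t) (0, 1)‖ ≤ ‖fderiv ℝ h (x, t)‖ := by
      have := (fderiv ℝ h (x, t)).le_opNorm ((0 : EE n), (1 : ℝ))
      simpa [Prod.norm_def] using this
    rw [Real.norm_eq_abs] at h3
    have h4 := neg_abs_le (fderiv ℝ h (x, t) (0, 1))
    have h5 : t * (-‖fderiv ℝ h (x, t)‖) ≤ t * fderiv ℝ h (x, t) (0, 1) :=
      mul_le_mul_of_nonneg_left (by linarith) ht.le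
    simp only at h1
    linarith
  have hcont : ∀ x : EE n, ContinuousOn (fun s : ℝ => s * h (x, s)) (Ioi 0) :=
    fun x t ht => (hder x t ht).continuousAt.continuousWithinAt
  have hmono : ∀ x : EE n, StrictMonoOn (fun s : ℝ => s * h (x, s)) (Ioi 0) := by
    intro x
    refine strictMonoOn_of_deriv_pos (convex_Ioi 0) (hcont x) ?_
    intro t ht
    rw [interior_Ioi] at ht
    rw [(hder x t ht).deriv]
    exact hpos x t ht
  refine ⟨?_, ?_, ?_⟩
  · rintro ⟨x, t⟩ ht
    have h2 := (hbd (x, t) ht).1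
    have ht' : 0 < t := ht
    exact mul_pos ht' (by linarith)
  · rintro ⟨x, t⟩ ht ⟨y, s⟩ hs hxy
    simp only [Prod.mk.injEq] at hxy
    obtain ⟨rfl, h2⟩ := hxy
    have := (hmono x).injOn (show t ∈ Ioi (0 : ℝ) from ht) (show s ∈ Ioi (0 : ℝ) from hs) h2
    rw [this]
  · rintro ⟨x, s⟩ hs
    have hs' : 0 < s := hs
    have ha : (0 : ℝ) < s / 2 := by linarith
    have hb : (0 : ℝ) < 2 * s := by linarith
    have hab : s / 2 ≤ 2 * s := by linarith
    have hc : ContinuousOn (fun r : ℝ => r * h (x, r)) (Icc (s / 2) (2 * s)) :=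
      (hcont x).mono fun r hr => lt_of_lt_of_le ha hr.1
    have h1 := (hbd (x, s / 2) ha).2
    have h2 := (hbd (x, 2 * s) hb).1
    obtain ⟨t, ht, hts⟩ := intermediate_value_Icc hab hc
      (show s ∈ Icc (s / 2 * h (x, s / 2)) (2 * s * h (x, 2 * s)) from
        ⟨by nlinarith, by nlinarith⟩)
    exact ⟨(x, t), lt_of_lt_of_le ha ht.1, Prod.ext rfl hts⟩

end
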